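/- (Unique linear extension of convex-linear maps; step 2 of the proof of Theorem 3.) Let V and W be real vector spaces, let s ⊆ V be a convex set containing 0 whose ℝ-linear span is all of V, and let f : V → W be a function with f(0) = 0 that preserves convex combinations of elements of s: for all x, y ∈ s and all t ∈ [0,1], f(t • x + (1−t) • y) = t • f(x) + (1−t) • f(y). Then there exists a unique real-linear map g : V → W such that g(x) = f(x) for all x ∈ s. -/

import Mathlib

section ConvexLinear

variable {V W : Type*} [AddCommGroup V] [Module ℝ V] [AddCommGroup W] [Module ℝ W]
  {s : Set V} {f : V → W}

/-- A nonnegative combination of two points of the graph of a convex-linear map on a convex set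
is a nonnegative multiple of a single point of the graph. -/
theorem exists_smul_eq_of_convexLinear (hconv : Convex ℝ s)
    (hf : ∀ x ∈ s, ∀ y ∈ s, ∀ t : ℝ, 0 ≤ t → t ≤ 1 →
      f (t • x + (1 - t) • y) = t • f x + (1 - t) • f y)
    {x y : V} (hx : x ∈ s) (hy : y ∈ s) {a b : ℝ} (ha : 0 ≤ a) (hb : 0 ≤ b) :
    ∃ z ∈ s, a • x + b • y = (a + b) • z ∧ a • f x + b • f y = (a + b) • f z := by
  rcases (add_nonneg ha hb).eq_or_lt with h | h
  · obtain rfl : a = 0 := by linarith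
    obtain rfl : b = 0 := by linarith
    exact ⟨x, hx, by simp, by simp⟩
  · have ht0 : 0 ≤ a / (a + b) := by positivity
    have ht1 : a / (a + b) ≤ 1 := (div_le_one h).2 (by linarith)
    have h1 : (a + b) * (a / (a + b)) = a := by field_simp
    have h2 : (a + b) * (1 - a / (a + b)) = b := by rw [mul_sub, h1]; ring
    refine ⟨(a / (a + b)) • x + (1 - a / (a + b)) • y,
      hconv hx hy ht0 (by linarith) (by ring), ?_, ?_⟩
    · rw [smul_add, smul_smul, smul_smul, h1, h2]
    · rw [hf x hx y hy _ ht0 ht1, smul_add, smul_smul, smul_smul, h1, h2]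

/-- A convex-linear map vanishing at `0 ∈ s` respects equalities between nonnegative multiples of
points of `s`. -/
theorem smul_eq_smul_of_convexLinear (h0 : (0 : V) ∈ s) (hf0 : f 0 = 0)
    (hf : ∀ x ∈ s, ∀ y ∈ s, ∀ t : ℝ, 0 ≤ t → t ≤ 1 →
      f (t • x + (1 - t) • y) = t • f x + (1 - t) • f y)
    {x y : V} (hx : x ∈ s) (hy : y ∈ s) {a b : ℝ} (ha : 0 ≤ a) (hb : 0 ≤ b)
    (h : a • x = b • y) : a • f x = b • f y := by
  have hscale : ∀ z ∈ s, ∀ t : ℝ, 0 ≤ t → t ≤ 1 → f (t • z) = t • f z := by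
    intro z hz t ht0 ht1
    simpa [hf0] using hf z hz 0 h0 t ht0 ht1
  have hM : 0 < a + b + 1 := by positivity
  have hfa := hscale x hx (a / (a + b + 1)) (by positivity) ((div_le_one hM).2 (by linarith))
  have hfb := hscale y hy (b / (a + b + 1)) (by positivity) ((div_le_one hM).2 (by linarith))
  have hxy : (a / (a + b + 1)) • x = (b / (a + b + 1)) • y := by
    rw [div_eq_inv_mul, div_eq_inv_mul, mul_smul, mul_smul, h]
  rw [hxy, hfb, div_eq_inv_mul, div_eq_inv_mul, mul_smul, mul_smul] at hfa
  exact (smul_right_injective W (inv_ne_zero hM.ne') hfa).symm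

/-- Every element of the span of the graph of a convex-linear map on a convex set is a difference
of nonnegative multiples of two points of the graph. -/
theorem exists_eq_sub_of_mem_span_graph (hconv : Convex ℝ s) (h0 : (0 : V) ∈ s)
    (hf : ∀ x ∈ s, ∀ y ∈ s, ∀ t : ℝ, 0 ≤ t → t ≤ 1 →
      f (t • x + (1 - t) • y) = t • f x + (1 - t) • f y)
    {p : V × W} (hp : p ∈ Submodule.span ℝ ((fun x => (x, f x)) '' s)) :
    ∃ x ∈ s, ∃ y ∈ s, ∃ a b : ℝ, 0 ≤ a ∧ 0 ≤ b ∧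
      p.1 = a • x - b • y ∧ p.2 = a • f x - b • f y := by
  induction hp using Submodule.span_induction with
  | mem p hp =>
    obtain ⟨x, hx, rfl⟩ := hp
    exact ⟨x, hx, x, hx, 1, 0, by simp⟩
  | zero => exact ⟨0, h0, 0, h0, 0, 0, by simp⟩
  | add p q _ _ ihp ihq =>
    obtain ⟨x, hx, y, hy, a, b, ha, hb, hp1, hp2⟩ := ihp
    obtain ⟨x', hx', y', hy', a', b', ha', hb', hq1, hq2⟩ := ihq
    obtain ⟨z, hz, hz1, hz2⟩ := exists_smul_eq_of_convexLinear hconv hf hx hx' ha ha'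
    obtain ⟨w, hw, hw1, hw2⟩ := exists_smul_eq_of_convexLinear hconv hf hy hy' hb hb'
    refine ⟨z, hz, w, hw, a + a', b + b', by positivity, by positivity, ?_, ?_⟩
    · rw [← hz1, ← hw1, Prod.fst_add, hp1, hq1]
      abel
    · rw [← hz2, ← hw2, Prod.snd_add, hp2, hq2]
      abel
  | smul c p _ ih =>
    obtain ⟨x, hx, y, hy, a, b, ha, hb, hp1, hp2⟩ := ih
    rcases le_total 0 c with hc | hc
    · refine ⟨x, hx, y, hy, c * a, c * b, by positivity, by positivity, ?_, ?_⟩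
      · rw [Prod.smul_fst, hp1, smul_sub, smul_smul, smul_smul]
      · rw [Prod.smul_snd, hp2, smul_sub, smul_smul, smul_smul]
    · refine ⟨y, hy, x, hx, -c * b, -c * a, mul_nonneg (neg_nonneg.2 hc) hb,
        mul_nonneg (neg_nonneg.2 hc) ha, ?_, ?_⟩
      · rw [Prod.smul_fst, hp1]
        module
      · rw [Prod.smul_snd, hp2]
        module

end ConvexLinear

/-- Unique linear extension of convex-linear maps (step 2 of the proof of
Theorem 3): if `s` is a convex subset of `V` containing `0` whose linear span
is all of `V`, and `f : V → W` satisfies `f 0 = 0` and preserves convex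
combinations of elements of `s`, then there is a unique linear map `g : V → W`
agreeing with `f` on `s`. -/
theorem convex_linear_unique_linear_extension
    {V W : Type*} [AddCommGroup V] [Module ℝ V] [AddCommGroup W] [Module ℝ W]
    (s : Set V) (hconv : Convex ℝ s) (h0 : (0 : V) ∈ s)
    (hspan : Submodule.span ℝ s = ⊤)
    (f : V → W) (hf0 : f 0 = 0)
    (hf : ∀ x ∈ s, ∀ y ∈ s, ∀ t : ℝ, 0 ≤ t → t ≤ 1 →
      f (t • x + (1 - t) • y) = t • f x + (1 - t) • f y) :
    ∃! g : V →ₗ[ℝ] W, ∀ x ∈ s, g x = f x := by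
  let G : Submodule ℝ (V × W) := Submodule.span ℝ ((fun x => (x, f x)) '' s)
  have hG : ∀ p ∈ G, p.1 = 0 → p.2 = 0 := by
    intro p hp hp0
    obtain ⟨x, hx, y, hy, a, b, ha, hb, hp1, hp2⟩ :=
      exists_eq_sub_of_mem_span_graph hconv h0 hf hp
    rw [hp2, sub_eq_zero]
    exact smul_eq_smul_of_convexLinear h0 hf0 hf hx hy ha hb (sub_eq_zero.1 (hp1 ▸ hp0))
  have hsurj : LinearMap.range ((LinearMap.fst ℝ V W).comp G.subtype) = ⊤ := by
    rw [LinearMap.range_comp, Submodule.range_subtype, Submodule.map_span, Set.image_image]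
    simpa using hspan
  obtain ⟨σ, hσ⟩ := LinearMap.exists_rightInverse_of_surjective _ hsurj
  have hext : ∀ x ∈ s, (LinearMap.snd ℝ V W).comp (G.subtype.comp σ) x = f x := by
    intro x hx
    have hσx : (σ x : V × W).1 = x := LinearMap.congr_fun hσ x
    have hmem : (σ x : V × W) - (x, f x) ∈ G :=
      G.sub_mem (σ x).2 (Submodule.subset_span ⟨x, hx, rfl⟩)
    exact sub_eq_zero.1 (hG _ hmem (sub_eq_zero.2 hσx))
  exact ⟨_, hext, fun g hg => LinearMap.ext_on hspan fun x hx => (hg x hx).trans (hext x hx).symm⟩
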